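/- Let Ψ be a planar-monotone-style CNF instance with n variables in which every clause has |L_h| ∈ {2,3}, and let G'_Ψ be the associated power-domination graph. Then G'_Ψ has a power dominating set of cardinality n if and only if Ψ is satisfiable. -/

import Mathlib

/-- A planar-monotone-style CNF instance with `n` variables and `m` clauses:
clause `h` consists of the set of variable indices `L h` together with a sign
`eps h` (`true` = all literals unnegated, `false` = all negated). -/
structure PMCnf (n m : ℕ) where
  L : Fin m → Finset (Fin n)
  eps : Fin m → Bool

/-- An assignment `a` satisfies `Ψ` if every clause contains a variable whose
value agrees with the sign of the clause. -/
def PMCnf.Satisfies {n m : ℕ} (Ψ : PMCnf n m) (a : Fin n → Bool) : Prop :=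
  ∀ h : Fin m, ∃ i ∈ Ψ.L h, a i = Ψ.eps h

/-- The closed neighborhood `Γ(S)` of a set of vertices. -/
def closedNbhd {V : Type*} (G : SimpleGraph V) (S : Set V) : Set V :=
  S ∪ {v | ∃ s ∈ S, G.Adj v s}

/-- `S` is a dominating set if `Γ(S) = V`. -/
def IsDominating {V : Type*} (G : SimpleGraph V) (S : Set V) : Prop :=
  closedNbhd G S = Set.univ

/-- `S₁(A)`: the vertices of `A` having exactly one neighbor outside `A`. -/
def pdS1 {V : Type*} (G : SimpleGraph V) (A : Set V) : Set V :=
  {s ∈ A | ∃! v, v ∉ A ∧ G.Adj s v}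

/-- The propagation operator `Γ₁(A) = A ∪ Γ(S₁(A))`. -/
def pdStep {V : Type*} (G : SimpleGraph V) (A : Set V) : Set V :=
  A ∪ closedNbhd G (pdS1 G A)

/-- `S` is a power dominating set if iterating `Γ₁` starting from `Γ(S)`
eventually covers all vertices. -/
def IsPowerDominating {V : Type*} (G : SimpleGraph V) (S : Set V) : Prop :=
  ∃ k : ℕ, (pdStep G)^[k] (closedNbhd G S) = Set.univ

/-- Validity predicate for clause-gadget vertices of `G'_Ψ`: `(h, Sum.inl l)`
is the vertex `z_{h,l}` (requires `l ∈ L h`), and `(h, Sum.inr 0)`,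
`(h, Sum.inr 1)` are the vertices `z_{h,h}`, `v_{h,h}` (present only when
clause `h` has exactly two literals). -/
def ClauseOk {n m : ℕ} (Ψ : PMCnf n m) : Fin m × (Fin n ⊕ Fin 2) → Prop
  | (h, Sum.inl l) => l ∈ Ψ.L h
  | (h, Sum.inr _) => (Ψ.L h).card = 2

/-- Vertices of the power-domination graph `G'_Ψ`: for each variable `i` the
six vertices `v_i = (i,0)`, `v̄_i = (i,1)`, `u_i = (i,2)`, `v'_i = (i,3)`,
`v̄'_i = (i,4)`, `u'_i = (i,5)`, together with the clause-gadget vertices. -/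
abbrev PVert {n m : ℕ} (Ψ : PMCnf n m) :=
  (Fin n × Fin 6) ⊕ {p : Fin m × (Fin n ⊕ Fin 2) // ClauseOk Ψ p}

/-- The base relation generating the edges of `G'_Ψ`.
* Within a variable gadget, `(i,a)` and `(i,b)` are adjacent iff
  `a ≢ b (mod 3)`, i.e. all pairs except `(v_i,v'_i)`, `(v̄_i,v̄'_i)`,
  `(u_i,u'_i)` (and loops) are edges.
* A clause-gadget vertex of clause `h` with slot `q` is adjacent to the
  literal vertex `w_i` (`= v_i` or `v̄_i` according to `eps h`) for each
  `i ∈ L h`, except that `z_{h,l}` is not adjacent to `w_l` itself.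
* Two clause-gadget vertices are adjacent iff they belong to the same clause,
  are distinct, and are not the pair `(z_{h,h}, v_{h,h})`. -/
def pdRel {n m : ℕ} (Ψ : PMCnf n m) : PVert Ψ → PVert Ψ → Prop
  | Sum.inl (i, a), Sum.inl (j, b) => i = j ∧ a.val % 3 ≠ b.val % 3
  | Sum.inl (i, a), Sum.inr ⟨(h, q), _⟩ =>
      a = (if Ψ.eps h then 0 else 1) ∧ i ∈ Ψ.L h ∧ ∀ l, q = Sum.inl l → l ≠ i
  | Sum.inr ⟨(h, q), _⟩, Sum.inl (i, a) =>
      a = (if Ψ.eps h then 0 else 1) ∧ i ∈ Ψ.L h ∧ ∀ l, q = Sum.inl l → l ≠ i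
  | Sum.inr ⟨(h, q), _⟩, Sum.inr ⟨(h', q'), _⟩ =>
      h = h' ∧ q ≠ q' ∧ (q.isLeft = true ∨ q'.isLeft = true)

/-- The power-domination graph `G'_Ψ` associated to the CNF instance `Ψ`. -/
def pdGraph {n m : ℕ} (Ψ : PMCnf n m) : SimpleGraph (PVert Ψ) :=
  SimpleGraph.fromRel (pdRel Ψ)

/-- The literal vertex `w_l` of clause `h`: `v_l` if `eps h = true`,
`v̄_l` if `eps h = false`. -/
def wV {n m : ℕ} (Ψ : PMCnf n m) (h : Fin m) (l : Fin n) : PVert Ψ :=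
  Sum.inl (l, if Ψ.eps h then 0 else 1)

/-- The clause-gadget vertex `z_{h,l}` (for `l ∈ L h`). -/
def zV {n m : ℕ} (Ψ : PMCnf n m) (h : Fin m) (l : Fin n) (hl : l ∈ Ψ.L h) :
    PVert Ψ :=
  Sum.inr ⟨(h, Sum.inl l), hl⟩

/-- The clause-gadget vertex `z_{h,h}` (for a clause with two literals). -/
def zhhV {n m : ℕ} (Ψ : PMCnf n m) (h : Fin m) (hc : (Ψ.L h).card = 2) :
    PVert Ψ :=
  Sum.inr ⟨(h, Sum.inr 0), hc⟩

/-- The clause-gadget vertex `v_{h,h}` (for a clause with two literals). -/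
def vhhV {n m : ℕ} (Ψ : PMCnf n m) (h : Fin m) (hc : (Ψ.L h).card = 2) :
    PVert Ψ :=
  Sum.inr ⟨(h, Sum.inr 1), hc⟩

section PowerDomination

variable {V : Type*} {G : SimpleGraph V}

/-- A nonempty set `F` disjoint from `Γ(S)` such that no vertex outside `F` has exactly one
neighbor in `F` obstructs power domination by `S`. -/
theorem not_isPowerDominating_of_fort {S F : Set V} (hne : F.Nonempty)
    (hdisj : Disjoint (closedNbhd G S) F)
    (hF : ∀ s ∉ F, ∀ v ∈ F, G.Adj s v → ∃ w ∈ F, w ≠ v ∧ G.Adj s w) :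
    ¬ IsPowerDominating G S := by
  rintro ⟨k, hk⟩
  have key : ∀ k, Disjoint ((pdStep G)^[k] (closedNbhd G S)) F := by
    intro k
    induction k with
    | zero => exact hdisj
    | succ k ih =>
      rw [Function.iterate_succ_apply']
      generalize (pdStep G)^[k] (closedNbhd G S) = A at ih
      rw [Set.disjoint_left] at ih ⊢
      rintro v (hv | hv | ⟨s, ⟨hsA, u, -, hu⟩, hvs⟩) hvF
      · exact ih hv hvF
      · exact ih hv.1 hvF
      · obtain ⟨w, hwF, hwv, hsw⟩ := hF s (ih hsA) v hvF hvs.symm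
        exact hwv ((hu w ⟨fun h => ih h hwF, hsw⟩).trans
          (hu v ⟨fun h => ih h hvF, hvs.symm⟩).symm)
  obtain ⟨x, hx⟩ := hne
  exact Set.disjoint_left.1 (key k) (hk ▸ Set.mem_univ x) hx

/-- A vertex `s ∈ A` all of whose neighbors other than `v` lie in `A` forces its neighbor `v`. -/
theorem mem_pdStep_of_adj {A : Set V} {s v : V} (hs : s ∈ A) (hsv : G.Adj s v)
    (h : ∀ w, w ≠ v → G.Adj s w → w ∈ A) : v ∈ pdStep G A := by
  by_cases hv : v ∈ A
  · exact Or.inl hv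
  · refine Or.inr (Or.inr ⟨s, ⟨hs, v, ⟨hv, hsv⟩, ?_⟩, hsv.symm⟩)
    rintro w ⟨hwA, hsw⟩
    by_contra hwv
    exact hwA (h w hwv hsw)

end PowerDomination

section PDGraph

variable {n m : ℕ} {Ψ : PMCnf n m}

theorem pdGraph_adj_inl_inl {i j : Fin n} {a b : Fin 6} :
    (pdGraph Ψ).Adj (Sum.inl (i, a)) (Sum.inl (j, b)) ↔ i = j ∧ a.val % 3 ≠ b.val % 3 := by
  simp only [pdGraph, SimpleGraph.fromRel_adj, pdRel]
  grind

theorem pdGraph_adj_inl_inr {i : Fin n} {a : Fin 6} {h : Fin m} {q : Fin n ⊕ Fin 2}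
    {hq : ClauseOk Ψ (h, q)} :
    (pdGraph Ψ).Adj (Sum.inl (i, a)) (Sum.inr ⟨(h, q), hq⟩) ↔
      a = (if Ψ.eps h then 0 else 1) ∧ i ∈ Ψ.L h ∧ q ≠ Sum.inl i := by
  simp only [pdGraph, SimpleGraph.fromRel_adj, pdRel]
  grind

theorem pdGraph_adj_inr_inr {h h' : Fin m} {q q' : Fin n ⊕ Fin 2}
    {hq : ClauseOk Ψ (h, q)} {hq' : ClauseOk Ψ (h', q')} :
    (pdGraph Ψ).Adj (Sum.inr ⟨(h, q), hq⟩) (Sum.inr ⟨(h', q'), hq'⟩) ↔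
      h = h' ∧ q ≠ q' ∧ (q.isLeft = true ∨ q'.isLeft = true) := by
  simp only [pdGraph, SimpleGraph.fromRel_adj, pdRel, ne_eq, Sum.inr.injEq, Subtype.mk.injEq,
    Prod.mk.injEq]
  grind

/-- A power dominating set contains a vertex of every variable gadget. -/
theorem exists_mem_gadget {S : Set (PVert Ψ)} (hS : IsPowerDominating (pdGraph Ψ) S)
    (i : Fin n) : ∃ a : Fin 6, Sum.inl (i, a) ∈ S := by
  by_contra! hno
  refine not_isPowerDominating_of_fort (F := {x | ∃ a : Fin 6, 2 ≤ a.val ∧ x = Sum.inl (i, a)})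
    ⟨_, 2, le_rfl, rfl⟩ ?_ ?_ hS
  · rw [Set.disjoint_left]
    rintro _ (hx | ⟨s, hs, hadj⟩) ⟨a, ha, rfl⟩
    · exact hno a hx
    · rcases s with ⟨j, b⟩ | ⟨⟨h, q⟩, hq⟩
      · obtain ⟨rfl, -⟩ := pdGraph_adj_inl_inl.1 hadj
        exact hno b hs
      · have := (pdGraph_adj_inl_inr.1 hadj).1
        split_ifs at this <;> subst this <;> simp at ha
  · rintro s hs _ ⟨a, ha, rfl⟩ hadj
    rcases s with ⟨j, b⟩ | ⟨⟨h, q⟩, hq⟩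
    · obtain ⟨rfl, hba⟩ := pdGraph_adj_inl_inl.1 hadj
      have hb : b.val < 2 := by
        by_contra! hb
        exact hs ⟨b, hb, rfl⟩
      obtain ⟨c, hc, hca, hbc⟩ : ∃ c : Fin 6, 2 ≤ c.val ∧ c ≠ a ∧ b.val % 3 ≠ c.val % 3 := by
        clear hs hadj
        revert a b
        decide
      exact ⟨_, ⟨c, hc, rfl⟩, by simpa using hca, pdGraph_adj_inl_inl.2 ⟨rfl, hbc⟩⟩
    · have := (pdGraph_adj_inl_inr.1 hadj.symm).1
      split_ifs at this <;> subst this <;> simp at ha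

/-- A power dominating set without clause-gadget vertices contains a literal vertex of every
clause. -/
theorem exists_literal_mem (hsz : ∀ h : Fin m, (Ψ.L h).card = 2 ∨ (Ψ.L h).card = 3)
    {S : Set (PVert Ψ)} (hS : IsPowerDominating (pdGraph Ψ) S) (hinr : ∀ p, Sum.inr p ∉ S)
    (h : Fin m) : ∃ i ∈ Ψ.L h, wV Ψ h i ∈ S := by
  by_contra! hno
  obtain ⟨l, hl⟩ : (Ψ.L h).Nonempty := by
    rw [← Finset.card_pos]
    rcases hsz h with h2 | h3 <;> omega
  refine not_isPowerDominating_of_fort (F := {x | ∃ q, ∃ hq : ClauseOk Ψ (h, q), x = Sum.inr ⟨(h, q), hq⟩})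
    ⟨_, Sum.inl l, hl, rfl⟩ ?_ ?_ hS
  · rw [Set.disjoint_left]
    rintro _ (hx | ⟨s, hs, hadj⟩) ⟨q, hq, rfl⟩
    · exact hinr _ hx
    · rcases s with ⟨j, b⟩ | p
      · obtain ⟨rfl, hj, -⟩ := pdGraph_adj_inl_inr.1 hadj.symm
        exact hno j hj hs
      · exact hinr _ hs
  · rintro s hs _ ⟨q, hq, rfl⟩ hadj
    rcases s with ⟨j, b⟩ | ⟨⟨h', q'⟩, hq'⟩
    · obtain ⟨rfl, hj, hqj⟩ := pdGraph_adj_inl_inr.1 hadj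
      obtain ⟨r, hr, hrq, hrj⟩ : ∃ r, ClauseOk Ψ (h, r) ∧ r ≠ q ∧ r ≠ Sum.inl j := by
        rcases hsz h with h2 | h3
        · by_cases hq0 : q = Sum.inr 0
          · exact ⟨Sum.inr 1, h2, by simp [hq0], by simp⟩
          · exact ⟨Sum.inr 0, h2, Ne.symm hq0, by simp⟩
        · rcases q with k | k
          · obtain ⟨t, ht, htn⟩ := Finset.exists_mem_notMem_of_card_lt_card
              (s := {j, k}) (t := Ψ.L h) (Finset.card_le_two.trans_lt (by omega))
            exact ⟨Sum.inl t, ht, by grind, by grind⟩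
          · have : (Ψ.L h).card = 2 := hq
            omega
      exact ⟨_, ⟨r, hr, rfl⟩, by simpa using hrq, pdGraph_adj_inl_inr.2 ⟨rfl, hj, hrj⟩⟩
    · obtain ⟨rfl, -⟩ := pdGraph_adj_inr_inr.1 hadj
      exact absurd ⟨q', hq', rfl⟩ hs

/-- The literal vertices made true by `a`. -/
def trueLiterals (Ψ : PMCnf n m) (a : Fin n → Bool) : Set (PVert Ψ) :=
  Set.range fun i => Sum.inl (i, if a i then 0 else 1)

theorem ncard_trueLiterals (a : Fin n → Bool) : (trueLiterals Ψ a).ncard = n := by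
  rw [trueLiterals, ← Set.image_univ, Set.ncard_image_of_injective, Set.ncard_univ,
    Nat.card_fin]
  intro i j hij
  simpa using congrArg (Sum.elim Prod.fst fun _ => i) hij

/-- The literal vertices made true by `a` dominate each variable gadget except for the twin
of the chosen vertex. -/
theorem inl_mem_closedNbhd_trueLiterals (a : Fin n → Bool) {i : Fin n} {b : Fin 6}
    (hb : b ≠ if a i then 3 else 4) :
    Sum.inl (i, b) ∈ closedNbhd (pdGraph Ψ) (trueLiterals Ψ a) := by
  by_cases hb' : b = if a i then 0 else 1
  · exact Or.inl ⟨i, by rw [hb']⟩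
  · refine Or.inr ⟨_, ⟨i, rfl⟩, pdGraph_adj_inl_inl.2 ⟨rfl, ?_⟩⟩
    generalize a i = c at hb hb' ⊢
    revert b c
    decide

theorem inr_mem_closedNbhd_trueLiterals {a : Fin n → Bool} {h : Fin m} {i : Fin n}
    (hi : i ∈ Ψ.L h) (hai : a i = Ψ.eps h) {q : Fin n ⊕ Fin 2} (hq : ClauseOk Ψ (h, q))
    (hqi : q ≠ Sum.inl i) :
    Sum.inr ⟨(h, q), hq⟩ ∈ closedNbhd (pdGraph Ψ) (trueLiterals Ψ a) :=
  Or.inr ⟨_, ⟨i, rfl⟩, (pdGraph_adj_inl_inr.2 ⟨by rw [hai], hi, hqi⟩).symm⟩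

theorem isPowerDominating_trueLiterals (hsz : ∀ h : Fin m, (Ψ.L h).card = 2 ∨ (Ψ.L h).card = 3)
    {a : Fin n → Bool} (ha : Ψ.Satisfies a) :
    IsPowerDominating (pdGraph Ψ) (trueLiterals Ψ a) := by
  refine ⟨1, Set.eq_univ_of_forall fun x => ?_⟩
  rw [Function.iterate_one]
  rcases x with ⟨i, b⟩ | ⟨⟨h, q⟩, hq⟩
  · by_cases hb : b = if a i then 3 else 4
    · refine mem_pdStep_of_adj (s := Sum.inl (i, 2))
        (inl_mem_closedNbhd_trueLiterals a (by split_ifs <;> decide))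
        (pdGraph_adj_inl_inl.2 ⟨rfl, by rw [hb]; split_ifs <;> decide⟩) ?_
      rintro (⟨j, c⟩ | ⟨⟨h, q⟩, hq⟩) hne hadj
      · obtain ⟨rfl, -⟩ := pdGraph_adj_inl_inl.1 hadj
        exact inl_mem_closedNbhd_trueLiterals a fun hc => hne (by rw [hc, hb])
      · have := (pdGraph_adj_inl_inr.1 hadj).1
        split_ifs at this <;> simp at this
    · exact Or.inl (inl_mem_closedNbhd_trueLiterals a hb)
  · obtain ⟨i, hi, hai⟩ := ha h
    by_cases hqi : q = Sum.inl i
    · subst hqi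
      obtain ⟨j, hj, hji⟩ := Finset.exists_mem_ne
        (s := Ψ.L h) (by rcases hsz h with h2 | h3 <;> omega) i
      refine mem_pdStep_of_adj (s := zV Ψ h j hj)
        (inr_mem_closedNbhd_trueLiterals hi hai (q := Sum.inl j) hj (by simpa using hji))
        (pdGraph_adj_inr_inr.2 ⟨rfl, by simpa using hji, Or.inl rfl⟩) ?_
      rintro (⟨k, c⟩ | ⟨⟨h', q⟩, hq'⟩) hne hadj
      · obtain ⟨rfl, -⟩ := pdGraph_adj_inl_inr.1 hadj.symm
        exact inl_mem_closedNbhd_trueLiterals a (by split_ifs <;> decide)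
      · obtain ⟨rfl, -⟩ := pdGraph_adj_inr_inr.1 hadj
        exact inr_mem_closedNbhd_trueLiterals hi hai hq' fun hq => hne (by subst hq; rfl)
    · exact Or.inl (inr_mem_closedNbhd_trueLiterals hi hai hq hqi)

end PDGraph

/-- If every clause of `Ψ` has two or three literals, then
`G'_Ψ` has a power dominating set of cardinality `n` iff `Ψ` is satisfiable. -/
theorem pdGraph_powerDominating_card_iff_satisfiable {n m : ℕ} (Ψ : PMCnf n m)
    (hsz : ∀ h : Fin m, (Ψ.L h).card = 2 ∨ (Ψ.L h).card = 3) :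
    (∃ S : Set (PVert Ψ), IsPowerDominating (pdGraph Ψ) S ∧ S.ncard = n) ↔
      ∃ a : Fin n → Bool, Ψ.Satisfies a := by
  constructor
  · rintro ⟨S, hS, hcard⟩
    choose c hc using exists_mem_gadget hS
    have hinj : Function.Injective fun i => (Sum.inl (i, c i) : PVert Ψ) := by
      intro i j hij
      simpa using congrArg (Sum.elim Prod.fst fun _ => i) hij
    have hSc : Set.range (fun i => (Sum.inl (i, c i) : PVert Ψ)) = S := by
      refine Set.eq_of_subset_of_ncard_le (Set.range_subset_iff.2 hc) ?_ (Set.toFinite S)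
      rw [hcard, ← Set.image_univ, Set.ncard_image_of_injective _ hinj, Set.ncard_univ,
        Nat.card_fin]
    refine ⟨fun i => decide (c i = 0), fun h => ?_⟩
    obtain ⟨i, hi, hiS⟩ := exists_literal_mem hsz hS (by simp [← hSc]) h
    refine ⟨i, hi, ?_⟩
    have hci : c i = if Ψ.eps h then 0 else 1 := by
      simpa [← hSc, wV] using hiS
    cases heps : Ψ.eps h <;> simp [hci, heps]
  · rintro ⟨a, ha⟩
    exact ⟨trueLiterals Ψ a, isPowerDominating_trueLiterals hsz ha, ncard_trueLiterals a⟩
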